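/- Let X, Y, Z be finite nonempty sets and g : X → Y, f : Y → Z functions. Then deg(f ∘ g) ≤ (max_{z∈Z} |f⁻¹(z)|) · deg(g). -/

import Mathlib

open Finset

/-- The degree of noninvertibility of `f`. -/
noncomputable def deg {X Y : Type*} [Fintype X] [Fintype Y] [DecidableEq Y] (f : X → Y) : ℝ :=
  (1 / (Fintype.card X : ℝ)) *
    ∑ y : Y, ((Finset.univ.filter (fun x => f x = y)).card : ℝ) ^ 2

theorem deg_comp_le {X Y Z : Type*} [Fintype X] [Fintype Y] [Fintype Z]
    [DecidableEq Y] [DecidableEq Z] [Nonempty X] [Nonempty Y] [Nonempty Z]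
    (g : X → Y) (f : Y → Z) :
    deg (f ∘ g) ≤
      ((Finset.univ.sup fun z : Z => (Finset.univ.filter (fun y => f y = z)).card : ℕ) : ℝ) *
        deg g := by
  unfold deg
  set M : ℕ := Finset.univ.sup fun z : Z => (Finset.univ.filter (fun y => f y = z)).card with hM
  have key : ∀ z : Z, ((Finset.univ.filter (fun x => (f ∘ g) x = z)).card : ℝ) ^ 2 ≤
      (M : ℝ) * ∑ y ∈ Finset.univ.filter (fun y => f y = z),
        ((Finset.univ.filter (fun x => g x = y)).card : ℝ) ^ 2 := by
    intro z
    have h1 : (Finset.univ.filter (fun x => (f ∘ g) x = z)).card =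
        ∑ y ∈ Finset.univ.filter (fun y => f y = z),
          (Finset.univ.filter (fun x => g x = y)).card := by
      rw [Finset.card_eq_sum_card_fiberwise (f := g)
        (t := Finset.univ.filter (fun y => f y = z)) (by intro x hx; simpa using hx)]
      refine Finset.sum_congr rfl fun y hy => ?_
      congr 1
      ext x
      simp only [Finset.mem_filter, Finset.mem_univ, true_and, Function.comp] at hy ⊢
      constructor
      · exact fun h => h.2
      · exact fun h => ⟨by rw [h, hy], h⟩
    have h2 : (Finset.univ.filter (fun y => f y = z)).card ≤ M :=
      Finset.le_sup (f := fun z : Z => (Finset.univ.filter (fun y => f y = z)).card)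
        (Finset.mem_univ z)
    rw [h1]
    push_cast
    refine sq_sum_le_card_mul_sum_sq.trans ?_
    exact mul_le_mul_of_nonneg_right (by exact_mod_cast h2)
      (Finset.sum_nonneg fun _ _ => sq_nonneg _)
  have tot : ∑ z : Z, ((Finset.univ.filter (fun x => (f ∘ g) x = z)).card : ℝ) ^ 2 ≤
      (M : ℝ) * ∑ y : Y, ((Finset.univ.filter (fun x => g x = y)).card : ℝ) ^ 2 := by
    refine (Finset.sum_le_sum fun z _ => key z).trans ?_
    rw [← Finset.mul_sum, Finset.sum_fiberwise]
  rw [mul_left_comm]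
  exact mul_le_mul_of_nonneg_left tot (by positivity)
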